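/- Let a > 0 and fix t ∈ ℝ. Define on [0,∞) the functions θ(t,x) = 3 a sinh(a t) cosh(a t)⁻³ cosh(3 a x)⁻¹ and h(x) = cosh(3 a x)^{1/3} sinh(3 a x). Then the spatial average of the square of the fluid expansion on the t = const slice vanishes: (∫₀^R θ(t,x)² h(x) dx) / (∫₀^R h(x) dx) → 0 as R → ∞. -/

import Mathlib

open MeasureTheory Filter intervalIntegral Real

theorem Real.tendsto_cosh_atTop_atTop : Tendsto Real.cosh atTop atTop := by
  refine tendsto_atTop_mono (f := fun x => Real.exp x / 2) (fun x => ?_)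
    (Real.tendsto_exp_atTop.atTop_div_const two_pos)
  rw [Real.cosh_eq]
  linarith [Real.exp_pos (-x)]

theorem integral_cosh_rpow_mul_sinh {k p : ℝ} (hk : k ≠ 0) (hp : p + 1 ≠ 0) (R : ℝ) :
    ∫ x in (0:ℝ)..R, Real.cosh (k * x) ^ p * Real.sinh (k * x) =
      (Real.cosh (k * R) ^ (p + 1) - 1) / (k * (p + 1)) := by
  have hderiv (x : ℝ) : HasDerivAt (fun x => Real.cosh (k * x) ^ (p + 1) / (k * (p + 1)))
      (Real.cosh (k * x) ^ p * Real.sinh (k * x)) x := by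
    have hcosh := ((hasDerivAt_id x).const_mul k).cosh.rpow_const (p := p + 1)
      (Or.inl (Real.cosh_pos _).ne')
    refine (hcosh.div_const (k * (p + 1))).congr_deriv ?_
    simp only [id, add_sub_cancel_right, mul_one]
    field_simp
  have hcont : Continuous fun x => Real.cosh (k * x) ^ p * Real.sinh (k * x) := by
    refine Continuous.mul ?_ (by fun_prop)
    exact Continuous.rpow_const (by fun_prop) fun x => Or.inl (Real.cosh_pos _).ne'
  rw [integral_eq_sub_of_hasDerivAt (fun x _ => hderiv x) (hcont.intervalIntegrable _ _)]
  simp [sub_div]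

/-- The spatial average of the square of the fluid expansion
`θ(t,x) = 3a sinh(at) cosh(at)⁻³ cosh(3ax)⁻¹` of the singularity-free solution on any
`t = const` slice, taken with the spatial volume density
`h(x) = cosh(3ax)^{1/3} sinh(3ax)`, vanishes. -/
theorem spatial_average_expansion_sq_vanishes
    (a : ℝ) (ha : 0 < a) (t : ℝ)
    (θ : ℝ → ℝ → ℝ) (h : ℝ → ℝ)
    (hθ : ∀ s x, θ s x = 3 * a * Real.sinh (a * s) * (Real.cosh (a * s)) ^ (-3 : ℝ) *
      (Real.cosh (3 * a * x)) ^ (-1 : ℝ))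
    (hh : ∀ x, h x = (Real.cosh (3 * a * x)) ^ ((1 : ℝ) / 3) * Real.sinh (3 * a * x)) :
    Tendsto
      (fun R : ℝ => (∫ x in (0:ℝ)..R, (θ t x) ^ 2 * h x) / ∫ x in (0:ℝ)..R, h x)
      atTop (nhds 0) := by
  have hk : 0 < 3 * a := by positivity
  have hcosh : Tendsto (fun R => Real.cosh (3 * a * R)) atTop atTop :=
    Real.tendsto_cosh_atTop_atTop.comp (tendsto_id.const_mul_atTop hk)
  have hsq (x : ℝ) : θ t x ^ 2 * h x =
      (3 * a * Real.sinh (a * t) * Real.cosh (a * t) ^ (-3 : ℝ)) ^ 2 *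
        (Real.cosh (3 * a * x) ^ (-5 / 3 : ℝ) * Real.sinh (3 * a * x)) := by
    have hpow : Real.cosh (3 * a * x) ^ (-5 / 3 : ℝ) =
        (Real.cosh (3 * a * x) ^ (-1 : ℝ)) ^ 2 * Real.cosh (3 * a * x) ^ ((1 : ℝ) / 3) := by
      rw [← Real.rpow_mul_natCast (Real.cosh_pos _).le, ← Real.rpow_add (Real.cosh_pos _)]
      norm_num
    rw [hθ, hh, hpow]
    ring
  simp only [hsq, intervalIntegral.integral_const_mul]
  simp only [hh, integral_cosh_rpow_mul_sinh hk.ne' (show (-5 / 3 : ℝ) + 1 ≠ 0 by norm_num),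
    integral_cosh_rpow_mul_sinh hk.ne' (show (1 / 3 : ℝ) + 1 ≠ 0 by norm_num)]
  have hnum : Tendsto (fun R => Real.cosh (3 * a * R) ^ (-5 / 3 + 1 : ℝ)) atTop (nhds 0) := by
    rw [show (-5 / 3 + 1 : ℝ) = -(2 / 3) by norm_num]
    exact (tendsto_rpow_neg_atTop (by norm_num)).comp hcosh
  have hden : Tendsto (fun R => Real.cosh (3 * a * R) ^ (1 / 3 + 1 : ℝ)) atTop atTop :=
    (tendsto_rpow_atTop (by norm_num)).comp hcosh
  have hpos : 0 < 3 * a * (1 / 3 + 1) := by positivity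
  exact (((hnum.sub_const 1).div_const _).const_mul _).div_atTop
    ((tendsto_atTop_add_const_right _ (-1) hden).atTop_div_const hpos)
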